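/- Geometric amplification of multiple-visit probabilities: Let Q be a stochastic matrix on a finite state space V, let y ∈ V, let t ≥ 0 and r ≥ 1 be integers, and let p ∈ [0,1]. Suppose that for every state x′, the probability that the t-step walk started at x′ satisfies N_t^{x′}(y) ≥ r is at most p. Then for every state x and every integer j ≥ 1, the probability that the t-step walk started at x satisfies N_t^x(y) ≥ r·j is at most p^j. -/

import Mathlib

open Finset

attribute [local instance] Classical.propDecidable

/-- The weight of a path `p : {0,…,t} → V` under the `t`-step walk measure
started at `x` with transition kernel `Q`. -/
noncomputable def walkWeight {V : Type*} [Fintype V] (Q : V → V → ℝ) (x : V) (t : ℕ)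
    (p : Fin (t + 1) → V) : ℝ :=
  (if p 0 = x then (1 : ℝ) else 0) * ∏ i : Fin t, Q (p i.castSucc) (p i.succ)

/-- `visits t p y` is the number of indices `0 ≤ i ≤ t` with `p i = y`. -/
noncomputable def visits {V : Type*} [Fintype V] (t : ℕ) (p : Fin (t + 1) → V) (y : V) : ℕ :=
  (Finset.univ.filter fun i => p i = y).card

/-- Probability of an event under the `t`-step walk measure started at `x`. -/
noncomputable def walkProb {V : Type*} [Fintype V] (Q : V → V → ℝ) (x : V) (t : ℕ)
    (E : (Fin (t + 1) → V) → Prop) : ℝ :=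
  ∑ p : Fin (t + 1) → V, if E p then walkWeight Q x t p else 0

/-- The probability that the `t`-step walk from `x` makes at least `n` visits to `y`, computed by
conditioning on the first step. -/
noncomputable def visitTail {V : Type*} [Fintype V] (Q : V → V → ℝ) (y : V) : ℕ → ℕ → V → ℝ
  | 0, n, x => if n ≤ (if x = y then 1 else 0) then 1 else 0
  | t + 1, n, x => ∑ v, Q x v * visitTail Q y t (n - if x = y then 1 else 0) v

section

variable {V : Type*} [Fintype V]

theorem visits_cons (t : ℕ) (a : V) (w : Fin (t + 1) → V) (y : V) :
    visits (t + 1) (Fin.cons a w : Fin (t + 2) → V) y = (if a = y then 1 else 0) + visits t w y := by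
  simp only [visits, Finset.card_filter, Fin.sum_univ_succ (n := t + 1), Fin.cons_zero,
    Fin.cons_succ]

theorem walkWeight_cons (Q : V → V → ℝ) (x : V) (t : ℕ) (a : V) (w : Fin (t + 1) → V) :
    walkWeight Q x (t + 1) (Fin.cons a w : Fin (t + 2) → V) =
      if a = x then ∑ v, Q x v * walkWeight Q v t w else 0 := by
  have hprod : ∏ i : Fin (t + 1), Q ((Fin.cons a w : Fin (t + 2) → V) i.castSucc)
      ((Fin.cons a w : Fin (t + 2) → V) i.succ) =
      Q a (w 0) * ∏ i : Fin t, Q (w i.castSucc) (w i.succ) := by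
    rw [Fin.prod_univ_succ]
    simp only [Fin.castSucc_zero, Fin.cons_zero, Fin.cons_succ, ← Fin.succ_castSucc]
  simp only [walkWeight, hprod, Fin.cons_zero]
  split_ifs with hax
  · subst hax
    simp
  · simp

theorem walkProb_visits_eq_visitTail (Q : V → V → ℝ) (y : V) (t n : ℕ) (x : V) :
    walkProb Q x t (fun w => n ≤ visits t w y) = visitTail Q y t n x := by
  induction t generalizing n x with
  | zero =>
    rw [walkProb, visitTail, ← (Equiv.funUnique (Fin 1) V).symm.sum_comp]
    simp only [walkWeight, visits, Finset.card_filter]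
    rw [Finset.sum_eq_single x]
    · simp
    · intro b _ hb
      simp [hb]
    · simp
  | succ t ih =>
    rw [walkProb, visitTail, ← (Fin.consEquiv fun _ : Fin (t + 2) => V).sum_comp,
      Fintype.sum_prod_type, Finset.sum_eq_single x]
    · simp only [← ih, walkProb, Finset.mul_sum]
      rw [Finset.sum_comm]
      refine Finset.sum_congr rfl fun w _ => ?_
      have hw := walkWeight_cons Q x t x w
      have hv := visits_cons t x w y
      simp only [Fin.consEquiv, Equiv.coe_fn_mk, hw, hv, if_true, tsub_le_iff_left]
      split_ifs <;> simp
    · intro b _ hb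
      refine Finset.sum_eq_zero fun w _ => ?_
      have hw := walkWeight_cons Q x t b w
      simp only [Fin.consEquiv, Equiv.coe_fn_mk, hw, if_neg hb, ite_self]
    · simp

variable {Q : V → V → ℝ}

theorem visitTail_nonneg (hQ0 : ∀ u v, 0 ≤ Q u v) (y : V) (t n : ℕ) (x : V) :
    0 ≤ visitTail Q y t n x := by
  induction t generalizing n x with
  | zero => rw [visitTail]; positivity
  | succ t ih => exact Finset.sum_nonneg fun v _ => mul_nonneg (hQ0 x v) (ih _ v)

theorem visitTail_zero_right (hQ1 : ∀ u, ∑ v, Q u v = 1) (y : V) (t : ℕ) (x : V) :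
    visitTail Q y t 0 x = 1 := by
  induction t generalizing x with
  | zero => simp [visitTail]
  | succ t ih => simp [visitTail, ih, hQ1]

theorem visitTail_mono (hQ0 : ∀ u v, 0 ≤ Q u v) (hQ1 : ∀ u, ∑ v, Q u v = 1) (y : V) (n : ℕ)
    (x : V) : Monotone fun t => visitTail Q y t n x := by
  refine monotone_nat_of_le_succ fun t => ?_
  induction t generalizing n x with
  | zero =>
    by_cases hn : n ≤ if x = y then 1 else 0
    · simp [visitTail, hn, hQ1]
    · rw [visitTail, if_neg hn]
      exact visitTail_nonneg hQ0 y _ n x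
  | succ t ih =>
    exact Finset.sum_le_sum fun v _ => mul_le_mul_of_nonneg_left (ih _ v) (hQ0 x v)

/-- After the `r`-th visit the walk restarts, so `m` further visits cost a factor bounding
the probability of `m` visits. -/
theorem visitTail_add_le (hQ0 : ∀ u v, 0 ≤ Q u v) (hQ1 : ∀ u, ∑ v, Q u v = 1) (y : V) (m : ℕ)
    {c : ℝ} (t : ℕ) (hc : ∀ z, visitTail Q y t m z ≤ c) {r : ℕ} (hr : 1 ≤ r) (x : V) :
    visitTail Q y t (r + m) x ≤ c * visitTail Q y t r x := by
  have hc0 : 0 ≤ c := (visitTail_nonneg hQ0 y t m x).trans (hc x)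
  induction t generalizing r x with
  | zero =>
    by_cases hrm : r + m ≤ if x = y then 1 else 0
    · have hle : (if x = y then 1 else 0) ≤ 1 := by split_ifs <;> simp
      obtain rfl : m = 0 := by omega
      have h1 := hc x
      rw [visitTail_zero_right hQ1] at h1
      simpa [visitTail, (by simpa using hrm : r ≤ if x = y then 1 else 0)] using h1
    · rw [visitTail, if_neg hrm]
      exact mul_nonneg hc0 (visitTail_nonneg hQ0 y 0 r x)
  | succ t ih =>
    have hc' : ∀ z, visitTail Q y t m z ≤ c := fun z =>
      (visitTail_mono hQ0 hQ1 y m z t.le_succ).trans (hc z)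
    simp only [visitTail, Finset.mul_sum]
    refine Finset.sum_le_sum fun v _ => ?_
    rw [mul_left_comm]
    refine mul_le_mul_of_nonneg_left ?_ (hQ0 x v)
    have hle : (if x = y then 1 else 0) ≤ 1 := by split_ifs <;> simp
    generalize (if x = y then 1 else 0) = d at hle
    rw [Nat.sub_add_comm (hle.trans hr)]
    rcases Nat.eq_zero_or_pos (r - d) with h0 | hpos
    · rw [h0, zero_add, visitTail_zero_right hQ1, mul_one]
      exact hc' v
    · exact ih hc' hpos v

end

/-- **Geometric amplification of multiple-visit probabilities.** -/
theorem geometric_amplification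
    {V : Type*} [Fintype V] (Q : V → V → ℝ)
    (hQ0 : ∀ u v : V, 0 ≤ Q u v) (hQ1 : ∀ u : V, ∑ v, Q u v = 1)
    (y : V) (t r : ℕ) (hr : 1 ≤ r) (p : ℝ) (hp0 : 0 ≤ p) (hp1 : p ≤ 1)
    (h : ∀ x' : V, walkProb Q x' t (fun w => r ≤ visits t w y) ≤ p) :
    ∀ (x : V) (j : ℕ), 1 ≤ j →
      walkProb Q x t (fun w => r * j ≤ visits t w y) ≤ p ^ j := by
  simp only [walkProb_visits_eq_visitTail] at h ⊢
  intro x j _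
  have key : ∀ (j : ℕ) (x : V), visitTail Q y t (r * j) x ≤ p ^ j := by
    intro j
    induction j with
    | zero => intro x; simp [visitTail_zero_right hQ1]
    | succ j ih =>
      intro x
      rw [Nat.mul_succ, add_comm, pow_succ]
      exact (visitTail_add_le hQ0 hQ1 y (r * j) t ih hr x).trans
        (mul_le_mul_of_nonneg_left (h x) (pow_nonneg hp0 j))
  exact key j x
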